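/- arXiv:math/0608278 — 3 statements merged into one kernel-verified Lean document; each statement's English description precedes it below -/
import Mathlib

section
/- Let n = 2^m with m ≥ 4. The set H = A^{m−1} is a linear subspace of F^n (closed under coordinatewise mod-2 addition and containing the zero word) and is an extended 1-perfect code of length n (the extended Hamming code). -/
open Finset Pointwise

abbrev Word (n : ℕ) := Fin n → ZMod 2

def FEv (n : ℕ) : Set (Word n) := {x | Even (hammingNorm x)}

def FOd (n : ℕ) : Set (Word n) := {x | ¬ Even (hammingNorm x)}

def nbr {n : ℕ} (S : Set (Word n)) : Set (Word n) := {y | ∃ x ∈ S, hammingDist y x = 1}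

def theta {n : ℕ} (G : Set (Word n)) : Set (Word n) :=
  {x | Even (hammingNorm x) ∧ nbr {x} ⊆ nbr G}

def ExtPerfect {n : ℕ} (C : Set (Word n)) : Prop :=
  C ⊆ FEv n ∧ (∀ x ∈ C, ∀ y ∈ C, x ≠ y → Disjoint (nbr {x}) (nbr {y})) ∧ nbr C = FOd n

def IsIsometry {n : ℕ} (g : Word n → Word n) : Prop :=
  Function.Bijective g ∧ ∀ x y, hammingDist (g x) (g y) = hammingDist x y

def embWord (m t : ℕ) (v : Word (2 ^ (m - t))) : Word (2 ^ m) := fun i =>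
  if h : (i : ℕ) < 2 ^ (m - t) then v ⟨i, h⟩
  else if h2 : (i : ℕ) < 2 * 2 ^ (m - t) then v ⟨(i : ℕ) - 2 ^ (m - t), by omega⟩
  else 0

def Vt (m t : ℕ) : Set (Word (2 ^ m)) :=
  {x | ∃ v : Word (2 ^ (m - t)), Even (hammingNorm v) ∧ x = embWord m t v}

def At (m : ℕ) : ℕ → Set (Word (2 ^ m))
  | 0 => {0}
  | 1 => Vt m 1
  | t + 2 => Vt m (t + 2) + At m (t + 1)

def IsComp (m t : ℕ) (G : Set (Word (2 ^ m))) : Prop :=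
  G ⊆ FEv (2 ^ m) ∧ G.ncard = (At m t).ncard ∧ nbr G = nbr (At m t)

def IsMuComp (m t : ℕ) (μ : Word (2 ^ m)) (M : Set (Word (2 ^ m))) : Prop :=
  (∀ i : Fin (2 ^ m), 2 ^ (m - t) ≤ (i : ℕ) → μ i = 0) ∧
  ∃ G, IsComp m t G ∧ M = (fun x => μ + x) '' G

def arrEntry (m t : ℕ) (x : Word (2 ^ m)) (i : Fin (2 ^ t)) (j : Fin (2 ^ (m - t))) : ZMod 2 :=
  x ⟨((i : ℕ) * 2 ^ (m - t) + (j : ℕ)) % 2 ^ m, Nat.mod_lt _ (Nat.two_pow_pos m)⟩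

def pchk (m t : ℕ) (x : Word (2 ^ m)) : Word (2 ^ (m - t)) :=
  fun j => ∑ i : Fin (2 ^ t), arrEntry m t x i j

def Bt (m : ℕ) : ℕ → Set (Word (2 ^ m))
  | 0 => Vt m 1
  | 1 => Vt m 1
  | t + 2 => Vt m (t + 2) + theta (At m (t + 1))

/-- The `j`-th binary digit of `i`, as an element of `ZMod 2`. -/
def bitWeight (j i : ℕ) : ZMod 2 := if i.testBit j then 1 else 0

/-- The words orthogonal to the all-ones word and to every binary-digit row: the extended Hamming
code given by its parity checks. -/
def extHamming (m : ℕ) : Submodule (ZMod 2) (Word (2 ^ m)) where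
  carrier := {x | ∑ i, x i = 0 ∧ ∀ j < m, ∑ i : Fin (2 ^ m), bitWeight j i * x i = 0}
  zero_mem' := by simp
  add_mem' := by
    rintro x y ⟨hx, hx'⟩ ⟨hy, hy'⟩
    refine ⟨by simp [Finset.sum_add_distrib, hx, hy], fun j hj => ?_⟩
    simp [mul_add, Finset.sum_add_distrib, hx' j hj, hy' j hj]
  smul_mem' := by
    rintro a x ⟨hx, hx'⟩
    refine ⟨by simp [← Finset.mul_sum, hx], fun j hj => ?_⟩
    simp [mul_left_comm, ← Finset.mul_sum, hx' j hj]

theorem mem_extHamming {m : ℕ} {x : Word (2 ^ m)} :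
    x ∈ extHamming m ↔ ∑ i, x i = 0 ∧ ∀ j < m, ∑ i : Fin (2 ^ m), bitWeight j i * x i = 0 := Iff.rfl

theorem natCast_hammingNorm {n : ℕ} (x : Word n) : (hammingNorm x : ZMod 2) = ∑ i, x i := by
  have h : ∀ a : ZMod 2, a = if a ≠ 0 then 1 else 0 := by decide
  rw [Finset.sum_congr rfl fun i _ => h (x i), Finset.sum_boole]
  rfl

theorem even_hammingNorm_iff {n : ℕ} (x : Word n) : Even (hammingNorm x) ↔ ∑ i, x i = 0 := by
  rw [← natCast_hammingNorm, ZMod.natCast_eq_zero_iff_even]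

theorem hammingDist_eq_one_iff {n : ℕ} (x y : Word n) :
    hammingDist x y = 1 ↔ ∃ i, x = y + Pi.single i 1 := by
  rw [hammingDist, Finset.card_eq_one]
  refine exists_congr fun i => ⟨fun h => funext fun k => ?_, ?_⟩
  · have hk := Finset.ext_iff.1 h k
    simp only [Finset.mem_filter, Finset.mem_univ, true_and, Finset.mem_singleton] at hk
    have key : ∀ a b : ZMod 2, a ≠ b → a = b + 1 := by decide
    by_cases hki : k = i
    · subst hki
      simpa using key _ _ (hk.2 rfl)
    · simpa [hki] using not_not.1 (mt hk.1 hki)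
  · rintro rfl
    ext k
    by_cases hki : k = i
    · subst hki; simp
    · simp [hki]

theorem sum_mul_embWord {m t : ℕ} (ht : 1 ≤ t) (htm : t ≤ m) (c : ℕ → ZMod 2)
    (v : Word (2 ^ (m - t))) :
    ∑ i : Fin (2 ^ m), c i * embWord m t v i =
      ∑ i : Fin (2 ^ (m - t)), (c i + c (i + 2 ^ (m - t))) * v i := by
  have hle : 2 ^ (m - t) + 2 ^ (m - t) ≤ 2 ^ m := by
    rw [← two_mul, ← pow_succ']
    exact Nat.pow_le_pow_right (by norm_num) (by omega)
  obtain ⟨r, hr⟩ := Nat.exists_eq_add_of_le hle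
  let w : ℕ → ZMod 2 := fun i => if h : i < 2 ^ (m - t) then v ⟨i, h⟩ else 0
  let g : ℕ → ZMod 2 := fun i =>
    if i < 2 ^ (m - t) then w i else if i < 2 * 2 ^ (m - t) then w (i - 2 ^ (m - t)) else 0
  have hg (i : Fin (2 ^ m)) : embWord m t v i = g i := by
    simp only [embWord, g, w]
    split_ifs <;> first | rfl | omega
  have hw (i : Fin (2 ^ (m - t))) : v i = w i := by simp [w]
  simp only [hg, hw]
  rw [← Finset.sum_range (fun i => c i * g i),
    ← Finset.sum_range (fun i => (c i + c (i + 2 ^ (m - t))) * w i), hr, Finset.sum_range_add,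
    Finset.sum_range_add]
  have h0 : ∑ x ∈ range r, c (2 ^ (m - t) + 2 ^ (m - t) + x) *
      g (2 ^ (m - t) + 2 ^ (m - t) + x) = 0 := by
    refine Finset.sum_eq_zero fun i _ => ?_
    have h1 : ¬ 2 ^ (m - t) + 2 ^ (m - t) + i < 2 ^ (m - t) := by
      rw [add_assoc]
      exact (Nat.le_add_right _ _).not_gt
    have h2 : ¬ 2 ^ (m - t) + 2 ^ (m - t) + i < 2 * 2 ^ (m - t) := by omega
    simp [g, h1, h2]
  rw [h0, add_zero, ← Finset.sum_add_distrib]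
  refine Finset.sum_congr rfl fun i hi => ?_
  have hi := Finset.mem_range.1 hi
  have h2 : 2 ^ (m - t) + i < 2 * 2 ^ (m - t) := by omega
  simp [g, hi, h2, add_mul, add_comm i]

theorem bitWeight_self_of_lt {k i : ℕ} (hi : i < 2 ^ k) : bitWeight k i = 0 := by
  simp [bitWeight, Nat.testBit_lt_two_pow hi]

theorem bitWeight_add_bitWeight {j k i : ℕ} (hi : i < 2 ^ k) :
    bitWeight j i + bitWeight j (i + 2 ^ k) = if j = k then 1 else 0 := by
  have two : (1 + 1 : ZMod 2) = 0 := by decide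
  rw [add_comm i]
  rcases lt_trichotomy j k with h | rfl | h
  · simp only [bitWeight, Nat.testBit_two_pow_add_gt h, if_neg h.ne]
    split_ifs <;> simp [two]
  · simp [bitWeight, Nat.testBit_two_pow_add_eq, Nat.testBit_lt_two_pow hi]
  · have hk : 2 ^ (k + 1) ≤ 2 ^ j := Nat.pow_le_pow_right (by norm_num) h
    rw [pow_succ] at hk
    simp [bitWeight, Nat.testBit_lt_two_pow (show 2 ^ k + i < 2 ^ j by omega),
      Nat.testBit_lt_two_pow (show i < 2 ^ j by omega), h.ne']

theorem sum_bitWeight_mul_embWord {m t : ℕ} (ht : 1 ≤ t) (htm : t ≤ m) (j : ℕ)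
    (v : Word (2 ^ (m - t))) :
    ∑ i : Fin (2 ^ m), bitWeight j i * embWord m t v i = if j = m - t then ∑ i, v i else 0 := by
  simp only [sum_mul_embWord ht htm, bitWeight_add_bitWeight (Fin.is_lt _)]
  split_ifs <;> simp

theorem embWord_mem_extHamming {m t : ℕ} (ht : 1 ≤ t) (htm : t ≤ m) {v : Word (2 ^ (m - t))}
    (hv : ∑ i, v i = 0) : embWord m t v ∈ extHamming m := by
  refine mem_extHamming.2 ⟨?_, fun j _ => ?_⟩
  · have two : (1 + 1 : ZMod 2) = 0 := by decide
    simpa [two] using sum_mul_embWord ht htm (fun _ => 1) v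
  · simp [sum_bitWeight_mul_embWord ht htm, hv]

theorem At_succ (m t : ℕ) : At m (t + 1) = Vt m (t + 1) + At m t := by
  cases t <;> simp [At]

theorem At_subset_extHamming {m t : ℕ} (htm : t ≤ m) : At m t ⊆ extHamming m := by
  induction t with
  | zero => simp [At]
  | succ t ih =>
    rw [At_succ]
    rintro _ ⟨_, ⟨v, hv, rfl⟩, y, hy, rfl⟩
    exact add_mem (embWord_mem_extHamming (by omega) htm ((even_hammingNorm_iff v).1 hv))
      (ih (by omega) hy)

theorem exists_embWord_of_mem_extHamming {m t : ℕ} (ht : 1 ≤ t) (htm : t ≤ m) {x : Word (2 ^ m)}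
    (hx : x ∈ extHamming m) (hsupp : ∀ i : Fin (2 ^ m), 2 ^ (m - t + 1) ≤ (i : ℕ) → x i = 0) :
    ∃ v : Word (2 ^ (m - t)), ∑ i, v i = 0 ∧
      ∀ i : Fin (2 ^ m), 2 ^ (m - t) ≤ (i : ℕ) → (x - embWord m t v) i = 0 := by
  have hle : 2 * 2 ^ (m - t) ≤ 2 ^ m := by
    rw [← pow_succ']
    exact Nat.pow_le_pow_right (by norm_num) (by omega)
  let v : Word (2 ^ (m - t)) := fun j => x ⟨j + 2 ^ (m - t), by omega⟩
  have hv : ∀ i : Fin (2 ^ m), 2 ^ (m - t) ≤ (i : ℕ) → (x - embWord m t v) i = 0 := by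
    intro i hi
    by_cases h2 : (i : ℕ) < 2 * 2 ^ (m - t)
    · simp [embWord, v, hi.not_gt, h2, Nat.sub_add_cancel hi]
    · simp [embWord, hi.not_gt, h2, hsupp i (by rw [pow_succ']; omega)]
  refine ⟨v, ?_, hv⟩
  have h0 : ∑ i : Fin (2 ^ m), bitWeight (m - t) i * (x - embWord m t v) i = 0 := by
    refine Finset.sum_eq_zero fun i _ => ?_
    rcases lt_or_ge (i : ℕ) (2 ^ (m - t)) with h | h
    · rw [bitWeight_self_of_lt h, zero_mul]
    · rw [hv i h, mul_zero]
  simpa [mul_sub, Finset.sum_sub_distrib, (mem_extHamming.1 hx).2 (m - t) (by omega),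
    sum_bitWeight_mul_embWord ht htm] using h0

theorem exists_mem_At_of_mem_extHamming {m t : ℕ} (htm : t ≤ m) {x : Word (2 ^ m)}
    (hx : x ∈ extHamming m) :
    ∃ y ∈ At m t, ∀ i : Fin (2 ^ m), 2 ^ (m - t) ≤ (i : ℕ) → (x - y) i = 0 := by
  induction t with
  | zero => exact ⟨0, by simp [At], fun i hi => absurd i.2 (not_lt.2 hi)⟩
  | succ t ih =>
    obtain ⟨y, hy, hxy⟩ := ih (by omega)
    obtain ⟨v, hv, hvs⟩ := exists_embWord_of_mem_extHamming (t := t + 1) (by omega) htm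
      (sub_mem hx (At_subset_extHamming (by omega) hy))
      (by rwa [show m - (t + 1) + 1 = m - t by omega])
    refine ⟨embWord m (t + 1) v + y, ?_, fun i hi => ?_⟩
    · rw [At_succ]
      exact Set.add_mem_add ⟨v, (even_hammingNorm_iff v).2 hv, rfl⟩ hy
    · rw [add_comm, ← sub_sub]
      exact hvs i hi

theorem eq_zero_of_mem_extHamming {m : ℕ} (hm : 1 ≤ m) {x : Word (2 ^ m)}
    (hx : x ∈ extHamming m) (hsupp : ∀ i : Fin (2 ^ m), 2 ≤ (i : ℕ) → x i = 0) : x = 0 := by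
  have hlt : 1 < 2 ^ m := Nat.one_lt_two_pow (by omega)
  obtain ⟨h1, h2⟩ := mem_extHamming.1 hx
  let a : Fin (2 ^ m) := ⟨0, by omega⟩
  let b : Fin (2 ^ m) := ⟨1, hlt⟩
  have hb : x b = 0 := by
    have h := h2 0 (by omega)
    rw [Finset.sum_eq_single b] at h
    · simpa [b, bitWeight] using h
    · intro i _ hi
      rcases Nat.lt_or_ge i 2 with hlt | hge
      · have : (i : ℕ) = 0 := by
          have : (i : ℕ) ≠ 1 := fun h => hi (Fin.ext h)
          omega
        simp [this, bitWeight]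
      · simp [hsupp i hge]
    · simp
  have hother (i : Fin (2 ^ m)) (hi : i ≠ a) : x i = 0 := by
    rcases Nat.lt_or_ge i 2 with hlt | hge
    · have hib : i = b := Fin.ext <| by
        have : (i : ℕ) ≠ 0 := fun h => hi (Fin.ext h)
        simp only [b]; omega
      rw [hib, hb]
    · exact hsupp i hge
  have ha : x a = 0 := by
    rwa [Finset.sum_eq_single a (fun i _ hi => hother i hi) (by simp)] at h1
  funext i
  by_cases hi : i = a
  · rw [hi, ha]; rfl
  · exact hother i hi

theorem At_pred_eq_extHamming {m : ℕ} (hm : 1 ≤ m) : At m (m - 1) = extHamming m := by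
  refine (At_subset_extHamming (by omega)).antisymm fun x hx => ?_
  obtain ⟨y, hy, hxy⟩ := exists_mem_At_of_mem_extHamming (t := m - 1) (by omega) hx
  rw [show m - (m - 1) = 1 by omega, pow_one] at hxy
  have h := eq_zero_of_mem_extHamming hm
    (sub_mem hx (At_subset_extHamming (by omega) hy)) hxy
  rwa [sub_eq_zero.1 h]

theorem sum_mul_add_single {n : ℕ} (c : Fin n → ZMod 2) (x : Word n) (i : Fin n) :
    ∑ k, c k * (x + Pi.single i 1 : Word n) k = ∑ k, c k * x k + c i := by
  simp [mul_add, Finset.sum_add_distrib, Pi.single_apply]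

theorem sum_add_single {n : ℕ} (x : Word n) (i : Fin n) :
    ∑ k, (x + Pi.single i 1 : Word n) k = ∑ k, x k + 1 := by
  simpa using sum_mul_add_single (fun _ => 1) x i

theorem bitWeight_injective {m : ℕ} {i k : Fin (2 ^ m)}
    (h : ∀ j < m, bitWeight j i = bitWeight j k) : i = k := by
  refine Fin.ext (Nat.eq_of_testBit_eq fun j => ?_)
  rcases lt_or_ge j m with hj | hj
  · have := h j hj
    simp only [bitWeight] at this
    cases h1 : (i : ℕ).testBit j <;> cases h2 : (k : ℕ).testBit j <;> simp_all
  · have hle : 2 ^ m ≤ 2 ^ j := Nat.pow_le_pow_right (by norm_num) hj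
    rw [Nat.testBit_lt_two_pow (i.2.trans_le hle), Nat.testBit_lt_two_pow (k.2.trans_le hle)]

theorem exists_bitWeight_eq {m : ℕ} (s : ℕ → ZMod 2) :
    ∃ i : Fin (2 ^ m), ∀ j < m, bitWeight j i = s j := by
  refine ⟨⟨Nat.ofBits fun j : Fin m => decide (s j = 1), Nat.ofBits_lt_two_pow _⟩, fun j hj => ?_⟩
  have key : ∀ a : ZMod 2, (if a = 1 then 1 else 0) = a := by decide
  simpa [bitWeight, Nat.testBit_ofBits_lt _ j hj] using key (s j)

theorem extPerfect_extHamming (m : ℕ) : ExtPerfect (extHamming m : Set (Word (2 ^ m))) := by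
  refine ⟨fun x hx => (even_hammingNorm_iff x).2 (mem_extHamming.1 hx).1, ?_, ?_⟩
  · intro x hx y hy hne
    refine Set.disjoint_left.2 ?_
    rintro z ⟨u, hu, hzx⟩ ⟨w, hw, hzy⟩
    rw [Set.mem_singleton_iff.1 hu] at hzx
    rw [Set.mem_singleton_iff.1 hw] at hzy
    obtain ⟨i, hi⟩ := (hammingDist_eq_one_iff _ _).1 hzx
    obtain ⟨k, hk⟩ := (hammingDist_eq_one_iff _ _).1 hzy
    have hik : i = k := bitWeight_injective fun j hj => by
      have h1 := sum_mul_add_single (fun l => bitWeight j l) x i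
      have h2 := sum_mul_add_single (fun l => bitWeight j l) y k
      rw [← hi, (mem_extHamming.1 hx).2 j hj, zero_add] at h1
      rw [← hk, (mem_extHamming.1 hy).2 j hj, zero_add] at h2
      exact h1.symm.trans h2
    subst hik
    exact hne (add_right_cancel (hi.symm.trans hk))
  · ext z
    simp only [nbr, FOd, Set.mem_ofPred_eq, even_hammingNorm_iff]
    constructor
    · rintro ⟨x, hx, hzx⟩
      obtain ⟨i, rfl⟩ := (hammingDist_eq_one_iff _ _).1 hzx
      rw [sum_add_single, (mem_extHamming.1 hx).1]
      decide
    · intro hz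
      have key : ∀ a : ZMod 2, a ≠ 0 → a + 1 = 0 := by decide
      have self : ∀ a : ZMod 2, a + a = 0 := by decide
      obtain ⟨i, hi⟩ := exists_bitWeight_eq (m := m) fun j => ∑ k : Fin (2 ^ m), bitWeight j k * z k
      refine ⟨z + Pi.single i 1, mem_extHamming.2 ⟨?_, fun j hj => ?_⟩, ?_⟩
      · rw [sum_add_single, key _ hz]
      · rw [sum_mul_add_single (fun l => bitWeight j l), hi j hj, self]
      · rw [hammingDist_comm, hammingDist_eq_one_iff]
        exact ⟨i, rfl⟩

/-- H = A^{m-1} is a linear subspace of F^n (contains 0, closed under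
coordinatewise mod-2 addition) and is an extended 1-perfect code (the extended Hamming code). -/
theorem stmt_0 (m : ℕ) (hm : 4 ≤ m) :
    (0 : Word (2 ^ m)) ∈ At m (m - 1) ∧
    (∀ x ∈ At m (m - 1), ∀ y ∈ At m (m - 1), x + y ∈ At m (m - 1)) ∧
    ExtPerfect (At m (m - 1)) := by
  rw [At_pred_eq_extHamming (by omega)]
  exact ⟨zero_mem _, fun _ hx _ hy => add_mem hx hy, extPerfect_extHamming m⟩
end

section
/- For all subsets G, G' ⊆ F_Ev^n, the equality Ω(G) = Ω(G') holds if and only if Θ(G) = Θ(G'). -/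
open Finset Pointwise

theorem subset_theta {n : ℕ} {G : Set (Word n)} (hG : G ⊆ FEv n) : G ⊆ theta G := by
  intro x hx
  refine ⟨hG hx, ?_⟩
  rintro y ⟨z, rfl, hyz⟩
  exact ⟨z, hx, hyz⟩

theorem nbr_theta {n : ℕ} {G : Set (Word n)} (hG : G ⊆ FEv n) : nbr (theta G) = nbr G := by
  apply Set.Subset.antisymm
  · rintro y ⟨x, hx, hyx⟩
    exact hx.2 ⟨x, rfl, hyx⟩
  · rintro y ⟨x, hx, hyx⟩
    exact ⟨x, subset_theta hG hx, hyx⟩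

/-- for all G, G' ⊆ F_Ev^n, Ω(G) = Ω(G') iff Θ(G) = Θ(G'). -/
theorem stmt_4 (n : ℕ) (G G' : Set (Word n)) (hG : G ⊆ FEv n) (hG' : G' ⊆ FEv n) :
    nbr G = nbr G' ↔ theta G = theta G' := by
  constructor
  · intro h
    simp only [theta, h]
  · intro h
    rw [← nbr_theta hG, h, nbr_theta hG']
end

section
/- For every t with 1 ≤ t ≤ m−1: Ω(A^t) = {x ∈ F^n : wt(p^t(x)) = 1}, and |Ω(A^t)| = 2^{2^{m−t}(2^t−1)+m−t}. -/
open Finset Pointwise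

theorem zmod_two_eq_zero_or_one (a : ZMod 2) : a = 0 ∨ a = 1 := by
  revert a; decide

theorem hammingNorm_eq_one_iff {n : ℕ} (x : Word n) :
    hammingNorm x = 1 ↔ ∃ a, x = Pi.single a 1 := by
  constructor
  · intro h
    obtain ⟨a, ha⟩ := Finset.card_eq_one.mp h
    refine ⟨a, funext fun j => ?_⟩
    have hj : x j ≠ 0 ↔ j = a := by
      rw [← Finset.mem_singleton, ← ha]; simp
    rcases eq_or_ne j a with rfl | hne
    · rw [Pi.single_eq_same]
      exact (zmod_two_eq_zero_or_one _).resolve_left (hj.2 rfl)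
    · rw [Pi.single_eq_of_ne hne]
      by_contra hx
      exact hne (hj.1 hx)
  · rintro ⟨a, rfl⟩
    refine Finset.card_eq_one.mpr ⟨a, ?_⟩
    ext j
    simp [Pi.single_apply]

theorem even_hammingNorm_iff_sum_eq_zero {n : ℕ} (x : Word n) :
    Even (hammingNorm x) ↔ ∑ j, x j = 0 := by
  have h : ∑ j, x j = (hammingNorm x : ZMod 2) := by
    rw [hammingNorm, Finset.card_filter, Nat.cast_sum]
    refine Finset.sum_congr rfl fun j _ => ?_
    rcases zmod_two_eq_zero_or_one (x j) with hj | hj <;> simp [hj]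
  rw [h, ZMod.natCast_eq_zero_iff_even]

theorem exists_even_hammingNorm_sub_double_eq_one_iff {N K : ℕ} (hK : K = 2 * N) (w : Word K) :
    (∃ v : Word N, Even (hammingNorm v) ∧ hammingNorm (fun j : Fin K => w j -
      if h : (j : ℕ) < N then v ⟨j, h⟩ else v ⟨j - N, by omega⟩) = 1) ↔
    hammingNorm (fun j : Fin N => w ⟨j, by omega⟩ + w ⟨j + N, by omega⟩) = 1 := by
  simp only [hammingNorm_eq_one_iff]
  constructor
  · rintro ⟨v, -, a, ha⟩
    have key : ∀ j : Fin N, w ⟨j, by omega⟩ + w ⟨j + N, by omega⟩ =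
        Pi.single (M := fun _ => ZMod 2) a 1 ⟨j, by omega⟩ +
        Pi.single (M := fun _ => ZMod 2) a 1 ⟨j + N, by omega⟩ := by
      intro j
      have h1 := congrFun ha ⟨j, by omega⟩
      have h2 := congrFun ha ⟨j + N, by omega⟩
      simp only [j.isLt, dite_true, Fin.eta] at h1
      simp only [Nat.not_lt.2 (Nat.le_add_left N j), dite_false, Nat.add_sub_cancel,
        Fin.eta] at h2
      rw [← h1, ← h2, CharTwo.sub_eq_add, CharTwo.sub_eq_add, add_add_add_comm,
        CharTwo.add_self_eq_zero, add_zero]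
    have haK := a.isLt
    refine ⟨if h : (a : ℕ) < N then ⟨a, h⟩ else ⟨a - N, by omega⟩, funext fun j => ?_⟩
    rw [key j]
    have hj := j.isLt
    simp only [Pi.single_apply, Fin.ext_iff]
    split_ifs <;> simp_all <;> omega
  · rintro ⟨a, ha⟩
    have hw : ∀ j : Fin N, w ⟨j, by omega⟩ + w ⟨j + N, by omega⟩ = if j = a then 1 else 0 :=
      fun j => (congrFun ha j).trans (Pi.single_apply ..)
    by_cases he : Even (hammingNorm fun j : Fin N => w ⟨j, by omega⟩)
    · refine ⟨_, he, ⟨a + N, by omega⟩, funext fun j => ?_⟩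
      have hj := j.isLt
      simp only [Pi.single_apply, Fin.ext_iff]
      split_ifs with h1 h2 h2
      · omega
      · simp
      · have := hw ⟨j - N, by omega⟩
        rw [if_pos (Fin.ext (by simp; omega))] at this
        simp only [Nat.sub_add_cancel (Nat.not_lt.1 h1), Fin.eta] at this
        rw [CharTwo.sub_eq_add, add_comm, this]
      · have := hw ⟨j - N, by omega⟩
        rw [if_neg (by simp only [Fin.ext_iff]; omega)] at this
        simp only [Nat.sub_add_cancel (Nat.not_lt.1 h1), Fin.eta] at this
        rw [CharTwo.sub_eq_add, add_comm, this]
    · have he' : Even (hammingNorm fun j : Fin N => w ⟨j + N, by omega⟩) := by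
        rw [even_hammingNorm_iff_sum_eq_zero] at he ⊢
        have hs : ∑ j : Fin N, (w ⟨j, by omega⟩ + w ⟨j + N, by omega⟩) = 1 := by
          simp [hw]
        rw [Finset.sum_add_distrib, (zmod_two_eq_zero_or_one _).resolve_left he] at hs
        simpa using hs
      refine ⟨_, he', ⟨a, by omega⟩, funext fun j => ?_⟩
      have hj := j.isLt
      simp only [Pi.single_apply, Fin.ext_iff]
      split_ifs with h1 h2 h2
      · have := hw ⟨j, h1⟩
        rw [if_pos (Fin.ext h2)] at this
        rw [CharTwo.sub_eq_add]; exact this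
      · have := hw ⟨j, h1⟩
        rw [if_neg (by simp only [Fin.ext_iff]; omega)] at this
        rw [CharTwo.sub_eq_add]; exact this
      · omega
      · simp [Nat.sub_add_cancel (Nat.not_lt.1 h1)]

theorem pchk_sub (m t : ℕ) (x y : Word (2 ^ m)) :
    pchk m t (x - y) = pchk m t x - pchk m t y := by
  funext j
  simp [pchk, arrEntry, Finset.sum_sub_distrib]

theorem pchk_eq_sum_range (m t : ℕ) (x : Word (2 ^ m)) (j : Fin (2 ^ (m - t))) :
    pchk m t x j = ∑ i ∈ Finset.range (2 ^ t),
      x ⟨(i * 2 ^ (m - t) + j) % 2 ^ m, Nat.mod_lt _ (Nat.two_pow_pos m)⟩ :=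
  Fin.sum_univ_eq_sum_range (fun i => x ⟨(i * 2 ^ (m - t) + j) % 2 ^ m,
    Nat.mod_lt _ (Nat.two_pow_pos m)⟩) (2 ^ t)

theorem two_pow_sub_eq_two_mul {m t : ℕ} (h : t + 1 ≤ m) :
    2 ^ (m - t) = 2 * 2 ^ (m - (t + 1)) := by
  rw [← pow_succ']; congr 1; omega

theorem sum_range_two_mul {M : Type*} [AddCommMonoid M] (f : ℕ → M) (k : ℕ) :
    ∑ i ∈ Finset.range (2 * k), f i = ∑ i ∈ Finset.range k, (f (2 * i) + f (2 * i + 1)) := by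
  induction k with
  | zero => simp
  | succ k ih => rw [Nat.mul_succ, Finset.sum_range_succ, Finset.sum_range_succ, ih,
      Finset.sum_range_succ, add_assoc]

theorem pchk_succ {m t : ℕ} (h : t + 1 ≤ m) (x : Word (2 ^ m)) :
    pchk m (t + 1) x = fun j : Fin (2 ^ (m - (t + 1))) =>
      pchk m t x ⟨j, by have := two_pow_sub_eq_two_mul h; omega⟩ +
      pchk m t x ⟨j + 2 ^ (m - (t + 1)), by have := two_pow_sub_eq_two_mul h; omega⟩ := by
  funext j
  simp only [pchk_eq_sum_range]
  rw [pow_succ' 2 t, sum_range_two_mul, Finset.sum_add_distrib]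
  congr 1 <;>
  · refine Finset.sum_congr rfl fun i _ => ?_
    congr 3
    rw [two_pow_sub_eq_two_mul h]
    ring

theorem pchk_embWord {m t : ℕ} (h : t + 1 ≤ m) (v : Word (2 ^ (m - (t + 1)))) :
    pchk m t (embWord m (t + 1) v) = fun j : Fin (2 ^ (m - t)) =>
      if hj : (j : ℕ) < 2 ^ (m - (t + 1)) then v ⟨j, hj⟩
      else v ⟨j - 2 ^ (m - (t + 1)), by have := two_pow_sub_eq_two_mul h; omega⟩ := by
  have hK := two_pow_sub_eq_two_mul h
  have hm : 2 ^ t * 2 ^ (m - t) = 2 ^ m := by rw [← pow_add]; congr 1; omega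
  funext j
  have hjlt := j.isLt
  have hlt : ∀ i < 2 ^ t, i * 2 ^ (m - t) + (j : ℕ) < 2 ^ m := by
    intro i hi
    have := Nat.mul_le_mul_right (2 ^ (m - t)) (Nat.succ_le_of_lt hi)
    rw [Nat.succ_mul] at this
    omega
  rw [pchk_eq_sum_range, Finset.sum_eq_single 0]
  · have h0 := hlt 0 (by positivity)
    rw [Nat.zero_mul, Nat.zero_add] at h0
    simp only [Nat.zero_mul, Nat.zero_add, Nat.mod_eq_of_lt h0, embWord]
    split_ifs
    · rfl
    · rfl
    · omega
  · intro i hi hi0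
    have h1 := Nat.le_mul_of_pos_left (2 ^ (m - t)) (Nat.pos_of_ne_zero hi0)
    simp only [Nat.mod_eq_of_lt (hlt i (Finset.mem_range.1 hi)), embWord]
    rw [dif_neg (by omega), dif_neg (by omega)]
  · simp

theorem pchk_zero (m : ℕ) (x : Word (2 ^ m)) : pchk m 0 x = x := by
  funext j
  rw [pchk_eq_sum_range]
  simp only [pow_zero, Finset.sum_range_one, Nat.zero_mul, Nat.zero_add]
  congr 1
  exact Fin.ext (Nat.mod_eq_of_lt j.isLt)

theorem nbr_At {m t : ℕ} (ht : t ≤ m) :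
    nbr (At m t) = {x : Word (2 ^ m) | hammingNorm (pchk m t x) = 1} := by
  induction t with
  | zero =>
    ext x
    simp only [nbr, At, Set.mem_singleton_iff, exists_eq_left, Set.mem_ofPred_eq,
      hammingDist_zero_right]
    rw [pchk_zero]
  | succ t ih =>
    ext x
    rw [Set.mem_ofPred_eq, pchk_succ ht,
      ← exists_even_hammingNorm_sub_double_eq_one_iff (two_pow_sub_eq_two_mul ht)]
    have hv : ∀ v : Word (2 ^ (m - (t + 1))), x - embWord m (t + 1) v ∈ nbr (At m t) ↔
        hammingNorm (fun j : Fin (2 ^ (m - t)) => pchk m t x j -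
          if h : (j : ℕ) < 2 ^ (m - (t + 1)) then v ⟨j, h⟩
          else v ⟨j - 2 ^ (m - (t + 1)),
            by have := two_pow_sub_eq_two_mul ht; omega⟩) = 1 := by
      intro v
      rw [ih (by omega), Set.mem_ofPred_eq, pchk_sub, pchk_embWord ht]
      rfl
    simp only [← hv]
    rw [At_succ]
    constructor
    · rintro ⟨_, ⟨_, ⟨v, hve, rfl⟩, a, ha, rfl⟩, hd⟩
      refine ⟨v, hve, a, ha, ?_⟩
      rw [hammingDist_eq_hammingNorm] at hd ⊢
      rwa [neg_sub, sub_eq_neg_add, add_assoc]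
    · rintro ⟨v, hve, a, ha, hd⟩
      refine ⟨_, Set.add_mem_add ⟨v, hve, rfl⟩ ha, ?_⟩
      rw [hammingDist_eq_hammingNorm] at hd ⊢
      rwa [neg_sub, sub_eq_neg_add, add_assoc] at hd

def pchkHom (m t : ℕ) : Word (2 ^ m) →+ Word (2 ^ (m - t)) :=
  AddMonoidHom.ofMapSub (pchk m t) (pchk_sub m t)

theorem pchkHom_apply (m t : ℕ) (x : Word (2 ^ m)) : pchkHom m t x = pchk m t x := rfl

theorem pchkHom_surjective {m t : ℕ} (ht : t ≤ m) : Function.Surjective (pchkHom m t) := by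
  induction t with
  | zero => exact fun y => ⟨y, pchk_zero m y⟩
  | succ t ih =>
    have hK := two_pow_sub_eq_two_mul ht
    intro y
    obtain ⟨x, hx⟩ := ih (by omega)
      (fun j => if h : (j : ℕ) < 2 ^ (m - (t + 1)) then y ⟨j, h⟩ else 0)
    refine ⟨x, ?_⟩
    rw [pchkHom_apply] at hx ⊢
    rw [pchk_succ ht, hx]
    funext j
    simp

theorem card_hammingNorm_eq_one (n : ℕ) :
    #{y : Word n | hammingNorm y = 1} = n := by
  have h : ({y : Word n | hammingNorm y = 1} : Finset (Word n)) =
      Finset.univ.image fun a : Fin n => (Pi.single a 1 : Word n) := by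
    ext y
    rw [Finset.mem_filter_univ, hammingNorm_eq_one_iff]
    simp [eq_comm]
  rw [h, Finset.card_image_of_injective, Finset.card_univ, Fintype.card_fin]
  intro a b hab
  by_contra hne
  have := congrFun hab a
  simp [Pi.single_eq_of_ne hne] at this

theorem card_filter_mem_mul_card {G H : Type*} [AddGroup G] [Fintype G] [AddGroup H] [Fintype H]
    [DecidableEq H] (f : G →+ H) (hf : Function.Surjective f) (T : Finset H) :
    #{x : G | f x ∈ T} * Fintype.card H = #T * Fintype.card G := by
  have hfib : ∀ S : Finset H, #{x : G | f x ∈ S} = #S * #{x : G | f x = 0} := by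
    intro S
    rw [Finset.card_eq_sum_card_fiberwise (f := f) (t := S) (by intro x hx; simpa using hx),
      Finset.sum_const_nat]
    intro y hy
    rw [← AddMonoidHom.card_fiber_eq_of_mem_range f (hf y) (hf 0), Finset.filter_filter]
    congr 1
    ext x
    simp only [Finset.mem_filter, Finset.mem_univ, true_and]
    exact ⟨fun h => h.2, fun h => ⟨h ▸ hy, h⟩⟩
  have hG := hfib Finset.univ
  simp only [Finset.mem_univ, Finset.filter_true, Finset.card_univ] at hG
  rw [hfib T, hG]
  ring

theorem ncard_hammingNorm_pchk_eq_one {m t : ℕ} (ht : t ≤ m) :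
    {x : Word (2 ^ m) | hammingNorm (pchk m t x) = 1}.ncard =
      2 ^ (2 ^ (m - t) * (2 ^ t - 1) + (m - t)) := by
  have h := card_filter_mem_mul_card (pchkHom m t) (pchkHom_surjective ht)
    {y | hammingNorm y = 1}
  have hm : 2 ^ (m - t) * (2 ^ t - 1) + 2 ^ (m - t) = 2 ^ m := by
    rw [← Nat.mul_succ, Nat.succ_eq_add_one, Nat.sub_add_cancel Nat.one_le_two_pow, ← pow_add]
    congr 1
    omega
  simp only [card_hammingNorm_eq_one, Finset.mem_filter, Finset.mem_univ, true_and,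
    pchkHom_apply, Fintype.card_fun, ZMod.card, Fintype.card_fin] at h
  rw [Set.ncard_eq_toFinset_card', Set.toFinset_ofPred]
  refine Nat.eq_of_mul_eq_mul_right (Nat.two_pow_pos (2 ^ (m - t))) (h.trans ?_)
  rw [← hm, ← pow_add, ← pow_add]
  congr 1
  ring

/-- for 1 ≤ t ≤ m-1, Ω(A^t) = {x : wt(p^t(x)) = 1} and
|Ω(A^t)| = 2^{2^{m-t}(2^t-1)+m-t}. -/
theorem stmt_6 (m t : ℕ) (hm : 4 ≤ m) (ht : 1 ≤ t) (ht' : t ≤ m - 1) :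
    nbr (At m t) = {x : Word (2 ^ m) | hammingNorm (pchk m t x) = 1} ∧
    (nbr (At m t)).ncard = 2 ^ (2 ^ (m - t) * (2 ^ t - 1) + (m - t)) := by
  have htm : t ≤ m := by omega
  rw [nbr_At htm]
  exact ⟨rfl, ncard_hammingNorm_pchk_eq_one htm⟩
end
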